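/- arXiv:2505.13858 — 5 statements merged into one kernel-verified Lean document; each statement's English description precedes it below -/
import Mathlib

section
/- Let P and S be symmetric k×k real matrices and suppose there exists x̄ ∈ ℝ^k with x̄ᵀ P x̄ > 0. Then the following are equivalent: (1) for all x ∈ ℝ^k, if xᵀ P x ≥ 0 then xᵀ S x ≥ 0; (2) there exists λ ≥ 0 such that S − λP is positive semidefinite. -/
open Matrix

theorem dotProduct_mulVec_smul_add {n : Type*} [Fintype n] (M : Matrix n n ℝ) (x y : n → ℝ)
    (t : ℝ) :
    (t • x + y) ⬝ᵥ (M *ᵥ (t • x + y)) =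
      x ⬝ᵥ (M *ᵥ x) * t ^ 2 + (x ⬝ᵥ (M *ᵥ y) + y ⬝ᵥ (M *ᵥ x)) * t + y ⬝ᵥ (M *ᵥ y) := by
  simp only [mulVec_add, mulVec_smul, add_dotProduct, dotProduct_add, smul_dotProduct,
    dotProduct_smul, smul_eq_mul]
  ring

/-- If a real quadratic `s t² + d t + u` is nonnegative wherever `a t² + c t + b` is, and
`b < 0 < a`, then `s b ≤ u a`: evaluate at the two roots, which have opposite signs. -/
theorem mul_le_mul_of_quadratic_nonneg_imp {a b c s d u : ℝ} (ha : 0 < a) (hb : b < 0)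
    (h : ∀ t : ℝ, 0 ≤ a * t ^ 2 + c * t + b → 0 ≤ s * t ^ 2 + d * t + u) :
    s * b ≤ u * a := by
  have hab : a * b < 0 := mul_neg_of_pos_of_neg ha hb
  have hdisc : 0 ≤ c ^ 2 - 4 * a * b := by nlinarith [sq_nonneg c]
  set r := √(c ^ 2 - 4 * a * b)
  have hr : r ^ 2 = c ^ 2 - 4 * a * b := Real.sq_sqrt hdisc
  have hcr : |c| < r := Real.lt_sqrt (abs_nonneg c) |>.2 (by rw [sq_abs]; linarith)
  obtain ⟨hcr₁, hcr₂⟩ := abs_lt.1 hcr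
  have hroot : ∀ ρ : ℝ, ρ ^ 2 = c ^ 2 - 4 * a * b →
      0 ≤ s * (ρ - c) ^ 2 + 2 * a * d * (ρ - c) + 4 * a ^ 2 * u := by
    intro ρ hρ
    have hzero : a * ((ρ - c) / (2 * a)) ^ 2 + c * ((ρ - c) / (2 * a)) + b = 0 := by
      field_simp
      linear_combination hρ
    calc
      0 ≤ 4 * a ^ 2 * (s * ((ρ - c) / (2 * a)) ^ 2 + d * ((ρ - c) / (2 * a)) + u) :=
        mul_nonneg (by positivity) (h _ hzero.ge)
      _ = s * (ρ - c) ^ 2 + 2 * a * d * (ρ - c) + 4 * a ^ 2 * u := by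
        field_simp
        ring
  have h₁ := mul_nonneg (by linarith : 0 ≤ r + c) (hroot r hr)
  have h₂ := mul_nonneg (by linarith : 0 ≤ r - c) (hroot (-r) (by rw [neg_sq, hr]))
  have hpos : 0 < 8 * a * r := by
    have : 0 < r := (abs_nonneg c).trans_lt hcr
    positivity
  refine le_of_mul_le_mul_left ?_ hpos
  linear_combination h₁ + h₂ + 2 * r * s * hr

/-- Homogeneous S-lemma: for symmetric matrices `P, S` with a Slater point
`x̄ᵀ P x̄ > 0`, the implication `xᵀ P x ≥ 0 → xᵀ S x ≥ 0` holds for all `x`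
iff there exists `λ ≥ 0` with `S - λ • P` positive semidefinite. -/
theorem homogeneous_s_lemma {k : ℕ} (P S : Matrix (Fin k) (Fin k) ℝ)
    (hP : P.IsSymm) (hS : S.IsSymm)
    (hSlater : ∃ xbar : Fin k → ℝ, 0 < xbar ⬝ᵥ (P *ᵥ xbar)) :
    (∀ x : Fin k → ℝ, 0 ≤ x ⬝ᵥ (P *ᵥ x) → 0 ≤ x ⬝ᵥ (S *ᵥ x)) ↔
      ∃ lam : ℝ, 0 ≤ lam ∧ (S - lam • P).PosSemidef := by
  have hquad (lam : ℝ) (x : Fin k → ℝ) :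
      x ⬝ᵥ ((S - lam • P) *ᵥ x) = x ⬝ᵥ (S *ᵥ x) - lam * x ⬝ᵥ (P *ᵥ x) := by
    simp [sub_mulVec, smul_mulVec, dotProduct_sub]
  constructor
  · intro h
    obtain ⟨x₀, hx₀⟩ := hSlater
    let ratio (x : {x : Fin k → ℝ // 0 < x ⬝ᵥ (P *ᵥ x)}) : ℝ :=
      x.1 ⬝ᵥ (S *ᵥ x.1) / x.1 ⬝ᵥ (P *ᵥ x.1)
    have : Nonempty {x : Fin k → ℝ // 0 < x ⬝ᵥ (P *ᵥ x)} := ⟨⟨x₀, hx₀⟩⟩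
    have hratio (x) : 0 ≤ ratio x := div_nonneg (h x.1 x.2.le) x.2.le
    have hbdd : BddBelow (Set.range ratio) := ⟨0, Set.forall_mem_range.2 hratio⟩
    refine ⟨⨅ x, ratio x, le_ciInf hratio, .of_dotProduct_mulVec_nonneg ?_ fun y => ?_⟩
    · rw [IsHermitian, conjTranspose_eq_transpose_of_trivial]
      exact hS.sub (hP.smul _)
    rw [star_trivial, hquad, sub_nonneg]
    rcases lt_trichotomy (y ⬝ᵥ (P *ᵥ y)) 0 with hy | hy | hy
    · rw [← div_le_iff_of_neg hy]
      refine le_ciInf fun x => ?_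
      rw [div_le_iff_of_neg hy, div_mul_eq_mul_div, div_le_iff₀ x.2]
      refine mul_le_mul_of_quadratic_nonneg_imp
        (c := x.1 ⬝ᵥ (P *ᵥ y) + y ⬝ᵥ (P *ᵥ x.1)) (d := x.1 ⬝ᵥ (S *ᵥ y) + y ⬝ᵥ (S *ᵥ x.1))
        x.2 hy fun t ht => ?_
      rw [← dotProduct_mulVec_smul_add] at ht ⊢
      exact h _ ht
    · simpa [hy] using h y hy.ge
    · rw [← le_div_iff₀ hy]
      exact ciInf_le hbdd ⟨y, hy⟩
  · rintro ⟨lam, hlam, hpsd⟩ x hx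
    have hx' := hpsd.dotProduct_mulVec_nonneg x
    rw [star_trivial, hquad] at hx'
    linarith [mul_nonneg hlam hx]
end

section
/- Let W₁ and S be symmetric k×k real matrices and t ∈ ℝ, and suppose there exists x̄ ∈ ℝ^k with x̄ᵀ W₁ x̄ > 0. If for every x ∈ ℝ^k the implication (xᵀ W₁ x ≥ 0 ⟹ xᵀ (S − t·I) x ≥ 0) holds, then there exists λ ≥ 0 such that S − λ W₁ − t·I is positive semidefinite. -/
open Matrix

/-- The homogeneous S-lemma for binary quadratic forms, with first form indefinite. -/
theorem mul_le_mul_of_binary_form_nonneg_imp {a b c p q r : ℝ} (ha : 0 < a) (hc : c < 0)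
    (h : ∀ u v : ℝ, 0 ≤ u ^ 2 * a + u * v * b + v ^ 2 * c →
      0 ≤ u ^ 2 * p + u * v * q + v ^ 2 * r) :
    c * p ≤ a * r := by
  have hac : 0 < -(a * c) := neg_pos.2 (mul_neg_of_pos_of_neg ha hc)
  set d := √((b / 2) ^ 2 - a * c)
  have hd : d ^ 2 = (b / 2) ^ 2 - a * c := Real.sq_sqrt (by linarith [sq_nonneg (b / 2)])
  have hbd : |b / 2| < d := Real.lt_sqrt (abs_nonneg _) |>.2 (by rw [sq_abs]; linarith)
  obtain ⟨hbd₁, hbd₂⟩ := abs_lt.1 hbd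
  have h₁ := h c (-(b / 2) - d) (le_of_eq (by linear_combination -c * hd))
  have h₂ := h c (-(b / 2) + d) (le_of_eq (by linear_combination -c * hd))
  have h₃ : 0 ≤ (2 * d * c) * (c * p - a * r) := by
    have e₁ := mul_nonneg (by linarith : 0 ≤ -(b / 2) + d) h₁
    have e₂ := mul_nonneg (by linarith : 0 ≤ b / 2 + d) h₂
    linear_combination e₁ + e₂ + (2 * d * r) * hd
  have hdc : 2 * d * c < 0 := mul_neg_of_pos_of_neg (by linarith [abs_nonneg (b / 2)]) hc
  exact sub_nonpos.1 (nonpos_of_mul_nonneg_right h₃ hdc)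

theorem dotProduct_mulVec_smul_add_smul {n R : Type*} [Fintype n] [CommRing R]
    (M : Matrix n n R) (y z : n → R) (u v : R) :
    (u • y + v • z) ⬝ᵥ (M *ᵥ (u • y + v • z)) =
      u ^ 2 * (y ⬝ᵥ (M *ᵥ y)) + u * v * (y ⬝ᵥ (M *ᵥ z) + z ⬝ᵥ (M *ᵥ y)) +
        v ^ 2 * (z ⬝ᵥ (M *ᵥ z)) := by
  simp only [mulVec_add, mulVec_smul, dotProduct_add, add_dotProduct, dotProduct_smul,
    smul_dotProduct, smul_eq_mul]
  ring

/-- The homogeneous S-lemma. -/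
theorem exists_nonneg_mul_le_of_nonneg_imp {n : Type*} [Fintype n] (A B : Matrix n n ℝ)
    (hpos : ∃ x, 0 < x ⬝ᵥ (A *ᵥ x))
    (h : ∀ x, 0 ≤ x ⬝ᵥ (A *ᵥ x) → 0 ≤ x ⬝ᵥ (B *ᵥ x)) :
    ∃ c : ℝ, 0 ≤ c ∧ ∀ x, c * (x ⬝ᵥ (A *ᵥ x)) ≤ x ⬝ᵥ (B *ᵥ x) := by
  obtain ⟨x₀, hx₀⟩ := hpos
  let f (y : {y // 0 < y ⬝ᵥ (A *ᵥ y)}) : ℝ := (y.1 ⬝ᵥ (B *ᵥ y.1)) / (y.1 ⬝ᵥ (A *ᵥ y.1))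
  have : Nonempty {y // 0 < y ⬝ᵥ (A *ᵥ y)} := ⟨⟨x₀, hx₀⟩⟩
  have hf (y) : 0 ≤ f y := div_nonneg (h _ y.2.le) y.2.le
  have hbdd : BddBelow (Set.range f) := ⟨0, Set.forall_mem_range.2 hf⟩
  refine ⟨⨅ y, f y, le_ciInf hf, fun z ↦ ?_⟩
  rcases lt_trichotomy (z ⬝ᵥ (A *ᵥ z)) 0 with hz | hz | hz
  · rw [← div_le_iff_of_neg hz]
    refine le_ciInf fun y ↦ ?_
    have := mul_le_mul_of_binary_form_nonneg_imp y.2 hz fun u v huv ↦ by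
      rw [← dotProduct_mulVec_smul_add_smul A] at huv
      rw [← dotProduct_mulVec_smul_add_smul B]
      exact h _ huv
    rw [div_le_iff_of_neg hz, div_mul_eq_mul_div, div_le_iff₀ y.2]
    linarith
  · rw [hz, mul_zero]
    exact h z hz.ge
  · exact (le_div_iff₀ hz).1 (ciInf_le hbdd ⟨z, hz⟩)

/-- Converse direction (`l = 1` case) of the SDP reformulation, from the
homogeneous S-lemma applied to `S - t • I`: if `x̄ᵀ W₁ x̄ > 0` for some `x̄` and
`xᵀ W₁ x ≥ 0 → xᵀ (S - t • I) x ≥ 0` for all `x`, then there exists `λ ≥ 0`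
with `S - λ • W₁ - t • I` positive semidefinite. -/
theorem sdp_reformulation_necessity_single {k : ℕ}
    (W₁ S : Matrix (Fin k) (Fin k) ℝ) (hW₁ : W₁.IsSymm) (hS : S.IsSymm)
    (t : ℝ)
    (hSlater : ∃ xbar : Fin k → ℝ, 0 < xbar ⬝ᵥ (W₁ *ᵥ xbar))
    (himp : ∀ x : Fin k → ℝ, 0 ≤ x ⬝ᵥ (W₁ *ᵥ x) →
      0 ≤ x ⬝ᵥ ((S - t • (1 : Matrix (Fin k) (Fin k) ℝ)) *ᵥ x)) :
    ∃ lam : ℝ, 0 ≤ lam ∧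
      (S - lam • W₁ - t • (1 : Matrix (Fin k) (Fin k) ℝ)).PosSemidef := by
  obtain ⟨c, hc, h⟩ := exists_nonneg_mul_le_of_nonneg_imp W₁ _ hSlater himp
  refine ⟨c, hc, .of_dotProduct_mulVec_nonneg ?_ fun x ↦ ?_⟩
  · rw [isHermitian_iff_isSymm]
    exact (hS.sub (hW₁.smul c)).sub (isSymm_one.smul t)
  · rw [star_trivial, sub_right_comm, sub_mulVec, smul_mulVec, dotProduct_sub, dotProduct_smul,
      smul_eq_mul, sub_nonneg]
    exact h x
end

section
/- Let X := {x ∈ ℝ^k : P x ≥ p} be a nonempty compact polyhedron with P ∈ ℝ^{l×k}, p ∈ ℝ^l, and let A ∈ ℝ^{m×n}, B ∈ ℝ^{m×k}, F ∈ ℝ^{n×k}, v ∈ ℝ^m, and t ∈ ℝ. Then (B − A F) x ≥ t·v for all x ∈ X if and only if there exists Λ ∈ ℝ^{m×l} with Λ ≥ 0 entrywise, A F + Λ P = B, and Λ p ≥ t·v. -/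
open Matrix

/-- **Farkas' lemma** for finitely many linear functionals on a real vector space. -/
theorem exists_nonneg_eq_sum_smul_of_forall_nonneg {V : Type*} [AddCommGroup V] [Module ℝ V]
    {l : ℕ} (a : Fin l → V →ₗ[ℝ] ℝ) (b : V →ₗ[ℝ] ℝ)
    (h : ∀ x, (∀ i, 0 ≤ a i x) → 0 ≤ b x) :
    ∃ w : Fin l → ℝ, (∀ i, 0 ≤ w i) ∧ b = ∑ i, w i • a i := by
  induction l generalizing b with
  | zero =>
    refine ⟨0, fun i => i.elim0, LinearMap.ext fun x => ?_⟩
    have h₁ := h x fun i => i.elim0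
    have h₂ := h (-x) fun i => i.elim0
    rw [map_neg] at h₂
    simp
    linarith
  | succ l ih =>
    by_cases hb : ∀ x, (∀ i : Fin l, 0 ≤ a i.succ x) → 0 ≤ b x
    · obtain ⟨w, hw, rfl⟩ := ih (fun i => a i.succ) b hb
      refine ⟨Fin.cons 0 w, Fin.cases le_rfl hw, ?_⟩
      simp [Fin.sum_univ_succ]
    · push Not at hb
      obtain ⟨y, hy, hby⟩ := hb
      have hay : a 0 y < 0 := by
        by_contra! h₀
        exact absurd (h y (Fin.cases h₀ hy)) hby.not_ge
      obtain ⟨z, hz, hbz, haz⟩ : ∃ z, (∀ i : Fin l, 0 ≤ a i.succ z) ∧ b z < 0 ∧ a 0 z = -1 := by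
        have hc : 0 < (-a 0 y)⁻¹ := inv_pos.2 (neg_pos.2 hay)
        refine ⟨(-a 0 y)⁻¹ • y, fun i => ?_, ?_, ?_⟩
        · simpa only [map_smul, smul_eq_mul] using mul_nonneg hc.le (hy i)
        · simpa only [map_smul, smul_eq_mul] using mul_neg_of_pos_of_neg hc hby
        · rw [map_smul, smul_eq_mul]
          field_simp [hay.ne]
      obtain ⟨w, hw, hbw⟩ := ih (fun i => a i.succ + a i.succ z • a 0) (b + b z • a 0) (by
        intro x hx
        have key := h (x + a 0 x • z) (Fin.cases (by simp [haz]) fun i => by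
          simpa [mul_comm] using hx i)
        simpa [mul_comm] using key)
      refine ⟨Fin.cons (∑ i, w i * a i.succ z - b z) w, Fin.forall_fin_succ.2 ⟨?_, hw⟩, ?_⟩
      · have : 0 ≤ ∑ i, w i * a i.succ z := Finset.sum_nonneg fun i _ => mul_nonneg (hw i) (hz i)
        change 0 ≤ ∑ i, w i * a i.succ z - b z
        linarith
      · rw [← eq_sub_iff_add_eq] at hbw
        rw [Fin.sum_univ_succ]
        simp only [Fin.cons_zero, Fin.cons_succ]
        generalize b z = β at hbw ⊢
        rw [hbw]
        simp only [smul_add, Finset.sum_add_distrib, smul_smul, ← Finset.sum_smul]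
        module

/-- **Affine Farkas' lemma**: a lower bound of a linear functional on a nonempty polyhedron
`{x | p ≤ P x}` is certified by nonnegative multipliers. -/
theorem exists_nonneg_vecMul_eq_of_forall_le {k l : ℕ}
    (P : Matrix (Fin l) (Fin k) ℝ) (p : Fin l → ℝ)
    (hne : {x : Fin k → ℝ | ∀ i, p i ≤ (P *ᵥ x) i}.Nonempty) (c : Fin k → ℝ) (τ : ℝ)
    (h : ∀ x : Fin k → ℝ, (∀ i, p i ≤ (P *ᵥ x) i) → τ ≤ c ⬝ᵥ x) :
    ∃ w : Fin l → ℝ, (∀ i, 0 ≤ w i) ∧ w ᵥ* P = c ∧ τ ≤ w ⬝ᵥ p := by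
  obtain ⟨x₀, hx₀⟩ := hne
  let φ (d : Fin k → ℝ) (σ : ℝ) : (Fin k → ℝ) × ℝ →ₗ[ℝ] ℝ :=
    (dotProductBilin ℝ ℝ d).coprod (-σ • LinearMap.id)
  have hφ (d σ x s) : φ d σ (x, s) = d ⬝ᵥ x - σ * s := by simp [φ, sub_eq_add_neg]
  obtain ⟨w, hw, hb⟩ := exists_nonneg_eq_sum_smul_of_forall_nonneg
    (Fin.cons (φ 0 (-1)) fun i => φ (P i) (p i)) (φ c τ) (by
      rintro ⟨x, s⟩ hx
      have hs : 0 ≤ s := by simpa [hφ] using hx 0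
      have hP (i) : p i * s ≤ P i ⬝ᵥ x := by simpa [hφ] using hx i.succ
      rw [hφ, sub_nonneg]
      rcases hs.eq_or_lt with rfl | hs
      · rw [mul_zero]
        by_contra! hc
        have hr : 0 ≤ (c ⬝ᵥ x₀ - τ + 1) / (-(c ⬝ᵥ x)) :=
          div_nonneg (by linarith [h x₀ hx₀]) (by linarith)
        have key := h (x₀ + ((c ⬝ᵥ x₀ - τ + 1) / (-(c ⬝ᵥ x))) • x) fun i => by
          have h₁ : p i ≤ P i ⬝ᵥ x₀ := hx₀ i
          have h₂ := mul_nonneg hr (by simpa using hP i)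
          change p i ≤ P i ⬝ᵥ _
          rw [dotProduct_add, dotProduct_smul, smul_eq_mul]
          linarith
        rw [dotProduct_add, dotProduct_smul, smul_eq_mul, div_neg, neg_mul,
          div_mul_cancel₀ _ hc.ne] at key
        linarith
      · have key := h (s⁻¹ • x) fun i => by
          change p i ≤ P i ⬝ᵥ _
          rw [dotProduct_smul, smul_eq_mul, ← div_eq_inv_mul, le_div_iff₀ hs]
          exact hP i
        rwa [dotProduct_smul, smul_eq_mul, ← div_eq_inv_mul, le_div_iff₀ hs] at key)
  have hb' (x s) : c ⬝ᵥ x - τ * s = w 0 * s + ∑ i, w i.succ * (P i ⬝ᵥ x - p i * s) := by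
    have := LinearMap.congr_fun hb (x, s)
    simpa [hφ, Fin.sum_univ_succ] using this
  refine ⟨fun i => w i.succ, fun i => hw _, funext fun j => ?_, ?_⟩
  · have := hb' (Pi.single j 1) 0
    simp at this
    rw [this]
    rfl
  · have := hb' 0 1
    simp at this
    have h₀ := hw 0
    simp only [dotProduct]
    linarith

/-- LP reformulation of the semi-infinite feasibility constraint of the
safe-network training problem with jointly linear constraints: over a nonempty
compact polyhedron `X = {x : P x ≥ p}`, we have `(B - A F) x ≥ t • v` for all
`x ∈ X` iff there exists `Λ ≥ 0` (entrywise) with `A F + Λ P = B` and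
`Λ p ≥ t • v`. -/
theorem lp_reformulation_jointly_linear {k l m n : ℕ}
    (P : Matrix (Fin l) (Fin k) ℝ) (p : Fin l → ℝ)
    (hne : {x : Fin k → ℝ | ∀ i, p i ≤ (P *ᵥ x) i}.Nonempty)
    (hcompact : IsCompact {x : Fin k → ℝ | ∀ i, p i ≤ (P *ᵥ x) i})
    (A : Matrix (Fin m) (Fin n) ℝ) (B : Matrix (Fin m) (Fin k) ℝ)
    (F : Matrix (Fin n) (Fin k) ℝ) (v : Fin m → ℝ) (t : ℝ) :
    (∀ x : Fin k → ℝ, (∀ i, p i ≤ (P *ᵥ x) i) →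
        ∀ i, t * v i ≤ ((B - A * F) *ᵥ x) i) ↔
      ∃ Λ : Matrix (Fin m) (Fin l) ℝ, (∀ i j, 0 ≤ Λ i j) ∧
        A * F + Λ * P = B ∧ ∀ i, t * v i ≤ (Λ *ᵥ p) i := by
  constructor
  · intro h
    choose Λ hΛ hP hp using fun i => exists_nonneg_vecMul_eq_of_forall_le P p hne
      ((B - A * F) i) (t * v i) fun x hx => h x hx i
    refine ⟨of Λ, hΛ, ?_, hp⟩
    have hΛP : of Λ * P = B - A * F := funext hP
    rw [hΛP, add_sub_cancel]
  · rintro ⟨Λ, hΛ, rfl, hp⟩ x hx i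
    rw [add_sub_cancel_left, ← mulVec_mulVec]
    exact (hp i).trans (dotProduct_le_dotProduct_of_nonneg_left hx (hΛ i))
end

section
/- Let G ∈ ℝ^{m_eq×n}, g ∈ ℝ^{m_eq}, H ∈ ℝ^{m_ineq×n}, h ∈ ℝ^{m_ineq}, and let y¹, y² ∈ ℝ^n satisfy G y¹ = g, G y² = g, and H y² ≤ h. Define slacks s¹ := h − H y¹ and s² := h − H y². If s¹ ≥ 0, set α := 0; otherwise set α := max_{i : s¹_i < 0} (−s¹_i)/(s²_i − s¹_i). Then α ∈ [0,1] and the point y := (1−α) y¹ + α y² satisfies G y = g and H y ≤ h, i.e., y ∈ C := {y ∈ ℝ^n : G y = g, H y ≤ h}. -/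
open Matrix

/-- Constraint satisfaction of the final architecture output: if `y¹` satisfies
the equality constraints, `y²` satisfies all constraints, and `α` is the
blending coefficient computed from the slacks `s¹ = h - H y¹`, `s² = h - H y²`
(`α = 0` if `s¹ ≥ 0`, otherwise `α = max_{i : s¹ᵢ < 0} (-s¹ᵢ)/(s²ᵢ - s¹ᵢ)`),
then `α ∈ [0,1]` and `y = (1-α) y¹ + α y²` lies in
`C = {y : G y = g, H y ≤ h}`. -/
theorem blended_output_feasible {meq mineq n : ℕ}
    (G : Matrix (Fin meq) (Fin n) ℝ) (g : Fin meq → ℝ)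
    (H : Matrix (Fin mineq) (Fin n) ℝ) (h : Fin mineq → ℝ)
    (y1 y2 : Fin n → ℝ)
    (hy1 : G *ᵥ y1 = g) (hy2 : G *ᵥ y2 = g) (hy2' : ∀ i, (H *ᵥ y2) i ≤ h i)
    (s1 s2 : Fin mineq → ℝ)
    (hs1 : s1 = h - H *ᵥ y1) (hs2 : s2 = h - H *ᵥ y2)
    (α : ℝ)
    (hα0 : (∀ i, 0 ≤ s1 i) → α = 0)
    (hα1 : ∀ hne : (Finset.univ.filter (fun i : Fin mineq => s1 i < 0)).Nonempty,
      α = (Finset.univ.filter (fun i : Fin mineq => s1 i < 0)).sup' hne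
            (fun i => (-s1 i) / (s2 i - s1 i))) :
    α ∈ Set.Icc (0 : ℝ) 1 ∧
    G *ᵥ ((1 - α) • y1 + α • y2) = g ∧
    ∀ i, (H *ᵥ ((1 - α) • y1 + α • y2)) i ≤ h i := by
  have hs1i : ∀ i, s1 i = h i - (H *ᵥ y1) i := fun i => by rw [hs1, Pi.sub_apply]
  have hs2i : ∀ i, s2 i = h i - (H *ᵥ y2) i := fun i => by rw [hs2, Pi.sub_apply]
  have hs2_nonneg : ∀ i, 0 ≤ s2 i := fun i => by linarith [hs2i i, hy2' i]
  obtain ⟨⟨hα_nonneg, hα_le⟩, hratio⟩ :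
      α ∈ Set.Icc (0 : ℝ) 1 ∧ ∀ i, s1 i < 0 → -s1 i / (s2 i - s1 i) ≤ α := by
    by_cases hs : ∀ i, 0 ≤ s1 i
    · rw [hα0 hs]
      exact ⟨by simp, fun i hi => absurd hi (hs i).not_gt⟩
    · push Not at hs
      obtain ⟨j, hj⟩ := hs
      have hne : (Finset.univ.filter (fun i : Fin mineq => s1 i < 0)).Nonempty :=
        ⟨j, by simpa using hj⟩
      have hle : ∀ i, s1 i < 0 → -s1 i / (s2 i - s1 i) ≤ α := fun i hi => by
        rw [hα1 hne]
        exact Finset.le_sup' (fun i => -s1 i / (s2 i - s1 i)) (by simpa using hi)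
      refine ⟨⟨le_trans ?_ (hle j hj), ?_⟩, hle⟩
      · exact div_nonneg (by linarith) (by linarith [hs2_nonneg j])
      · rw [hα1 hne]
        refine Finset.sup'_le hne _ fun i hi => ?_
        have hi' : s1 i < 0 := by simpa using hi
        exact div_le_one_of_le₀ (by linarith [hs2_nonneg i]) (by linarith [hs2_nonneg i])
  refine ⟨⟨hα_nonneg, hα_le⟩, ?_, fun i => ?_⟩
  · rw [mulVec_add, mulVec_smul, mulVec_smul, hy1, hy2, ← add_smul, sub_add_cancel, one_smul]
  · rw [mulVec_add, mulVec_smul, mulVec_smul]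
    simp only [Pi.add_apply, Pi.smul_apply, smul_eq_mul]
    suffices 0 ≤ (1 - α) * s1 i + α * s2 i by
      rw [hs1i, hs2i] at this
      linarith
    rcases le_or_gt 0 (s1 i) with hi | hi
    · exact add_nonneg (mul_nonneg (sub_nonneg.2 hα_le) hi) (mul_nonneg hα_nonneg (hs2_nonneg i))
    · have := (div_le_iff₀ (by linarith [hs2_nonneg i])).1 (hratio i hi)
      linarith
end

section
/- Fix k, n, m, l ∈ ℕ and let e₁ ∈ ℝ^k be the first standard basis vector. Let P₁, …, P_l be symmetric k×k matrices and define X := {x ∈ ℝ^k : e₁ᵀ x = 1 and xᵀ P_j x ≥ 0 for all j = 1, …, l}. Let A_ℓ ∈ ℝ^{k×n} and b_ℓ ∈ ℝ^k for ℓ = 1, …, m, let m_eq ≤ m, and suppose F ∈ ℝ^{n×k}, symmetric matrices S₁, …, S_m ∈ ℝ^{k×k}, Λ ∈ ℝ^{m×l} with Λ ≥ 0 entrywise, and t ≥ 0 satisfy: (a) (1/2)(A_ℓ F + Fᵀ A_ℓᵀ) + S_ℓ = (1/2)(e₁ b_ℓᵀ + b_ℓ e₁ᵀ) for all ℓ =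 1, …, m, and (b) S_ℓ − Σ_{j=1}^l Λ_{ℓj} P_j − t·I is positive semidefinite for all ℓ = m_eq+1, …, m. Then for every x ∈ X: xᵀ A_ℓ F x + xᵀ S_ℓ x = b_ℓᵀ x for all ℓ = 1, …, m, and xᵀ S_ℓ x ≥ t for all ℓ = m_eq+1, …, m. -/
open Matrix

/-- Soundness of the SDP reformulation of the safe-network training problem
with input-dependent left-hand side coefficients: any feasible solution
`(F, S₁,…,S_m, Λ, t)` of the SDP yields a linear decision rule `x ↦ F x`
satisfying, for every `x` in the input set
`X = {x : e₁ᵀ x = 1, xᵀ P_j x ≥ 0 ∀j}`, the quadratic equality constraints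
`xᵀ A_ℓ F x + xᵀ S_ℓ x = b_ℓᵀ x` (for all `ℓ`) and the slack lower bounds
`xᵀ S_ℓ x ≥ t` (for the inequality rows `ℓ > m_eq`). Here indices `ℓ` range
over `Fin m` (0-based), so the rows `ℓ = m_eq+1,…,m` of the paper correspond
to `meq ≤ (ℓ : ℕ)`. -/
theorem sdp_reformulation_soundness {k n m l : ℕ} [NeZero k]
    (meq : ℕ) (hmeq : meq ≤ m)
    (P : Fin l → Matrix (Fin k) (Fin k) ℝ) (hP : ∀ j, (P j).IsSymm)
    (A : Fin m → Matrix (Fin k) (Fin n) ℝ) (b : Fin m → Fin k → ℝ)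
    (F : Matrix (Fin n) (Fin k) ℝ)
    (S : Fin m → Matrix (Fin k) (Fin k) ℝ) (hS : ∀ ℓ, (S ℓ).IsSymm)
    (Λ : Matrix (Fin m) (Fin l) ℝ) (hΛ : ∀ i j, 0 ≤ Λ i j)
    (t : ℝ) (ht : 0 ≤ t)
    (hEq : ∀ ℓ : Fin m,
      (1 / 2 : ℝ) • (A ℓ * F + (A ℓ * F)ᵀ) + S ℓ =
        (1 / 2 : ℝ) • (vecMulVec (Pi.single (0 : Fin k) (1 : ℝ)) (b ℓ) +
          vecMulVec (b ℓ) (Pi.single (0 : Fin k) (1 : ℝ))))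
    (hPSD : ∀ ℓ : Fin m, meq ≤ (ℓ : ℕ) →
      (S ℓ - ∑ j, Λ ℓ j • P j - t • (1 : Matrix (Fin k) (Fin k) ℝ)).PosSemidef)
    (x : Fin k → ℝ)
    (hx1 : (Pi.single (0 : Fin k) (1 : ℝ)) ⬝ᵥ x = 1)
    (hxP : ∀ j, 0 ≤ x ⬝ᵥ (P j *ᵥ x)) :
    (∀ ℓ : Fin m, x ⬝ᵥ ((A ℓ * F) *ᵥ x) + x ⬝ᵥ (S ℓ *ᵥ x) = b ℓ ⬝ᵥ x) ∧
    (∀ ℓ : Fin m, meq ≤ (ℓ : ℕ) → t ≤ x ⬝ᵥ (S ℓ *ᵥ x)) := by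
  refine ⟨fun ℓ => ?_, fun ℓ hℓ => ?_⟩
  · have h := congrArg (fun M => x ⬝ᵥ (M *ᵥ x)) (hEq ℓ)
    have hT : x ⬝ᵥ ((A ℓ * F)ᵀ *ᵥ x) = x ⬝ᵥ ((A ℓ * F) *ᵥ x) := by
      rw [mulVec_transpose, dotProduct_comm, ← dotProduct_mulVec]
    have hx1' : x ⬝ᵥ Pi.single (0 : Fin k) (1 : ℝ) = 1 := by rw [dotProduct_comm, hx1]
    simp only [add_mulVec, smul_mulVec, dotProduct_add, dotProduct_smul, smul_eq_mul,
      vecMulVec_mulVec, op_smul_eq_smul, hT, hx1, hx1', dotProduct_comm x (b ℓ)] at h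
    linarith
  · have h := (hPSD ℓ hℓ).dotProduct_mulVec_nonneg x
    simp only [star_trivial, sub_mulVec, sum_mulVec, smul_mulVec, one_mulVec, dotProduct_sub,
      dotProduct_sum, dotProduct_smul, smul_eq_mul] at h
    have hsum : 0 ≤ ∑ j, Λ ℓ j * (x ⬝ᵥ (P j *ᵥ x)) :=
      Finset.sum_nonneg fun j _ => mul_nonneg (hΛ ℓ j) (hxP j)
    have hx0 : x 0 = 1 := by simpa using hx1
    have hxx : 1 ≤ x ⬝ᵥ x := by
      have := Finset.single_le_sum (f := fun i => x i * x i)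
        (fun i _ => mul_self_nonneg (x i)) (Finset.mem_univ 0)
      simpa [dotProduct, hx0] using this
    have := mul_le_mul_of_nonneg_left hxx ht
    linarith
end
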